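/- arXiv:1911.10032 — 2 statements merged into one kernel-verified Lean document; each statement's English description precedes it below -/
import Mathlib

section
/- Let 0 < s < d and let E ⊆ ℝ^d be a Borel set that is mid-point convex and satisfies 0 < H^s(E) < ∞. Then E is essentially convex. -/
open MeasureTheory Set Metric Filter
open scoped ENNReal

/-- A set `E ⊆ ℝ^d` is mid-point convex if the midpoint of any two of its points
belongs to it. -/
def MidpointConvexSet {d : ℕ} (E : Set (EuclideanSpace ℝ (Fin d))) : Prop :=
  ∀ x ∈ E, ∀ y ∈ E, midpoint ℝ x y ∈ E

/-- A set `E ⊆ ℝ^d` is essentially convex if there are an integer `1 ≤ s ≤ d` and an affine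
subspace `L` of dimension `s` containing `E` such that, in the subspace topology of `L`,
`E` has nonempty interior and `convexHull E \ E` lies in the frontier of `convexHull E`. -/
def EssentiallyConvex {d : ℕ} (E : Set (EuclideanSpace ℝ (Fin d))) : Prop :=
  ∃ s : ℕ, 1 ≤ s ∧ s ≤ d ∧
    ∃ L : AffineSubspace ℝ (EuclideanSpace ℝ (Fin d)),
      Module.finrank ℝ L.direction = s ∧
      E ⊆ (L : Set (EuclideanSpace ℝ (Fin d))) ∧
      (interior ((Subtype.val : L → EuclideanSpace ℝ (Fin d)) ⁻¹' E)).Nonempty ∧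
      (Subtype.val : L → EuclideanSpace ℝ (Fin d)) ⁻¹' (convexHull ℝ E \ E) ⊆
        frontier ((Subtype.val : L → EuclideanSpace ℝ (Fin d)) ⁻¹' (convexHull ℝ E))

open Topology Module Pointwise

section MidpointConvex

variable {V : Type*} [AddCommGroup V] [Module ℝ V] {E : Set V}

lemma lineMap_natCast_div_two_pow_mem
    (hmid : ∀ x ∈ E, ∀ y ∈ E, midpoint ℝ x y ∈ E) {x y : V} (hx : x ∈ E) (hy : y ∈ E) (n : ℕ) :
    ∀ k : ℕ, k ≤ 2 ^ n → AffineMap.lineMap x y ((k : ℝ) / 2 ^ n) ∈ E := by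
  induction n with
  | zero =>
    intro k hk
    interval_cases k <;> simpa
  | succ n ih =>
    intro k hk
    have h₁ := ih (k / 2) (by rw [pow_succ] at hk; omega)
    have h₂ := ih (k - k / 2) (by rw [pow_succ] at hk; omega)
    convert hmid _ h₁ _ h₂ using 1
    rw [← AffineMap.map_midpoint, midpoint_eq_smul_add, Nat.cast_sub (Nat.div_le_self k 2)]
    congr 1
    simp only [invOf_eq_inv, smul_eq_mul]
    field_simp
    ring

lemma inv_two_pow_card_smul_sum_mem
    (hmid : ∀ x ∈ E, ∀ y ∈ E, midpoint ℝ x y ∈ E) (h0 : (0 : V) ∈ E) {ι : Type*} (t : Finset ι)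
    (v : ι → V) (hv : ∀ i ∈ t, v i ∈ E) : ((2 : ℝ) ^ t.card)⁻¹ • ∑ i ∈ t, v i ∈ E := by
  classical
  induction t using Finset.induction_on with
  | empty => simpa
  | insert i t hi ih =>
    have h₁ := ih fun j hj ↦ hv j (Finset.mem_insert_of_mem hj)
    have h₂ := lineMap_natCast_div_two_pow_mem hmid h0 (hv i (Finset.mem_insert_self i t)) t.card 1
      Nat.one_le_two_pow
    convert hmid _ h₂ _ h₁ using 1
    rw [Finset.sum_insert hi, Finset.card_insert_of_notMem hi, midpoint_eq_smul_add,
      AffineMap.lineMap_apply_module, smul_zero, zero_add, Nat.cast_one, one_div, ← smul_add,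
      smul_smul, pow_succ, mul_inv_rev, invOf_eq_inv]

lemma sum_natCast_smul_add_mem_smul
    (hmid : ∀ x ∈ E, ∀ y ∈ E, midpoint ℝ x y ∈ E) (h0 : (0 : V) ∈ E) {ι : Type*} [Fintype ι]
    {b : ι → V} (hb : ∀ i, b i ∈ E) {n : ℕ} {k : ι → ℕ} (hk : ∀ i, k i ≤ 2 ^ n)
    {e : V} (he : e ∈ E) :
    ∑ i, (k i : ℝ) • b i + e ∈ ((2 : ℝ) ^ (n + (Fintype.card ι + 1))) • E := by
  have h := inv_two_pow_card_smul_sum_mem hmid h0 (Finset.univ : Finset (Option ι))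
    (fun o ↦ o.elim (AffineMap.lineMap 0 e (((1 : ℕ) : ℝ) / 2 ^ n))
      fun i ↦ AffineMap.lineMap 0 (b i) ((k i : ℝ) / 2 ^ n)) (by
      rintro (_ | i) -
      · exact lineMap_natCast_div_two_pow_mem hmid h0 he n 1 Nat.one_le_two_pow
      · exact lineMap_natCast_div_two_pow_mem hmid h0 (hb i) n _ (hk i))
  rw [Set.mem_smul_set_iff_inv_smul_mem₀ (by positivity)]
  convert h using 1
  rw [Finset.card_univ, Fintype.card_option, Fintype.sum_option, pow_add, mul_inv, mul_comm,
    mul_smul]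
  congr 1
  simp only [Option.elim, AffineMap.lineMap_apply_module, smul_zero, zero_add, smul_add,
    Finset.smul_sum, smul_smul, Nat.cast_one, one_div]
  rw [add_comm]
  congr 1
  exact Finset.sum_congr rfl fun i _ ↦ by rw [div_eq_inv_mul]

end MidpointConvex

section Topological

variable {V : Type*} [NormedAddCommGroup V] [NormedSpace ℝ V] {E : Set V}

lemma convex_closure_of_midpoint_mem (hmid : ∀ x ∈ E, ∀ y ∈ E, midpoint ℝ x y ∈ E) :
    Convex ℝ (closure E) := by
  have hcl : ∀ x ∈ closure E, ∀ y ∈ closure E, midpoint ℝ x y ∈ closure E := by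
    intro x hx y hy
    refine map_mem_closure₂ (f := fun x y : V ↦ midpoint ℝ x y) ?_ hx hy hmid
    simp only [midpoint_eq_smul_add]
    fun_prop
  rw [convex_iff_segment_subset]
  intro x hx y hy
  rw [segment_eq_image_lineMap]
  rintro _ ⟨t, ht, rfl⟩
  have hlim : Tendsto (fun n : ℕ ↦ AffineMap.lineMap x y
      ((⌊t * 2 ^ n⌋₊ : ℝ) / 2 ^ n)) atTop (𝓝 (AffineMap.lineMap x y t)) :=
    (AffineMap.lineMap_continuous.tendsto t).comp
      ((tendsto_nat_floor_mul_div_atTop ht.1).comp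
        (tendsto_pow_atTop_atTop_of_one_lt (one_lt_two (α := ℝ))))
  refine isClosed_closure.mem_of_tendsto hlim (Eventually.of_forall fun n ↦ ?_)
  refine lineMap_natCast_div_two_pow_mem hcl hx hy n _ ?_
  refine Nat.floor_le_of_le ?_
  push_cast
  exact mul_le_of_le_one_left (by positivity) ht.2

lemma interior_convexHull_subset_of_midpoint_mem
    (hmid : ∀ x ∈ E, ∀ y ∈ E, midpoint ℝ x y ∈ E) (hne : (interior E).Nonempty) :
    interior (convexHull ℝ E) ⊆ E := by
  obtain ⟨c, hc⟩ := hne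
  intro y hy
  have hsub : convexHull ℝ E ⊆ closure E :=
    convexHull_min subset_closure (convex_closure_of_midpoint_mem hmid)
  have hcont : ContinuousAt (fun t : ℝ ↦ (1 - t)⁻¹ • (y - t • c)) 0 := by
    refine ContinuousAt.smul (ContinuousAt.inv₀ (by fun_prop) (by simp)) (by fun_prop)
  have hlim : Tendsto (fun n : ℕ ↦ (1 - (2⁻¹ : ℝ) ^ n)⁻¹ • (y - (2⁻¹ : ℝ) ^ n • c)) atTop
      (𝓝 y) := by
    have := hcont.tendsto.comp
      (tendsto_pow_atTop_nhds_zero_of_lt_one (by norm_num : (0 : ℝ) ≤ 2⁻¹) (by norm_num))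
    simpa [Function.comp_def] using this
  obtain ⟨n, hn, hn₁⟩ :=
    ((hlim.eventually (isOpen_interior.mem_nhds hy)).and (eventually_ge_atTop 1)).exists
  have hlt : (2⁻¹ : ℝ) ^ n < 1 := pow_lt_one₀ (by norm_num) (by norm_num) (by omega)
  have hpos : (0 : ℝ) < 2⁻¹ ^ n := by positivity
  set t : ℝ := 2⁻¹ ^ n with ht
  have h1t : (1 - t) ≠ 0 := by linarith
  have hmem := hsub (interior_subset hn)
  have hcont' : Continuous fun e : V ↦ t⁻¹ • (y - (1 - t) • e) := by fun_prop
  have hval : t⁻¹ • (y - (1 - t) • ((1 - t)⁻¹ • (y - t • c))) = c := by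
    rw [smul_inv_smul₀ h1t, sub_sub_cancel, inv_smul_smul₀ hpos.ne']
  obtain ⟨e, he', he⟩ := mem_closure_iff_nhds.1 hmem _
    (hcont'.continuousAt.preimage_mem_nhds (by rw [hval]; exact mem_interior_iff_mem_nhds.1 hc))
  have key := lineMap_natCast_div_two_pow_mem hmid he he' n 1 Nat.one_le_two_pow
  have hk : ((1 : ℕ) : ℝ) / 2 ^ n = t := by rw [ht, Nat.cast_one, one_div, inv_pow]
  rw [hk, AffineMap.lineMap_apply_module,
    smul_inv_smul₀ hpos.ne', add_sub_cancel] at key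
  exact key

lemma exists_abs_repr_sub_lt {ι : Type*} [Fintype ι] (b : Basis ι ℝ V)
    {F : Set V} (hF : Bornology.IsBounded F) :
    ∃ a : ℕ, ∀ x ∈ F, ∀ y ∈ F, ∀ i, |b.repr x i - b.repr y i| < 2 ^ a := by
  obtain ⟨R, hR⟩ := isBounded_iff.1 (b.equivFunL.toContinuousLinearMap.lipschitz.isBounded_image hF)
  obtain ⟨a, ha⟩ := pow_unbounded_of_one_lt R (one_lt_two (α := ℝ))
  refine ⟨a, fun x hx y hy i ↦ lt_of_le_of_lt ?_ ha⟩
  have h := (dist_le_pi_dist _ _ i).trans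
    (hR (mem_image_of_mem b.equivFunL.toContinuousLinearMap hx)
      (mem_image_of_mem b.equivFunL.toContinuousLinearMap hy))
  simpa [Real.dist_eq] using h

end Topological

section Measure

lemma exists_bounded_subset_hausdorffMeasure_pos {X : Type*} [NormedAddCommGroup X]
    [MeasurableSpace X] [BorelSpace X] {E : Set X} {s : ℝ} (hE : MeasurableSet E)
    (hpos : 0 < μH[s] E) :
    ∃ F ⊆ E, MeasurableSet F ∧ Bornology.IsBounded F ∧ 0 < μH[s] F := by
  have hU : ⋃ n : ℕ, E ∩ closedBall 0 n = E := by
    rw [← inter_iUnion, iUnion_closedBall_nat, inter_univ]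
  obtain ⟨n, hn⟩ := exists_measure_pos_of_not_measure_iUnion_null
    (μ := μH[s]) (s := fun n : ℕ ↦ E ∩ closedBall 0 n) (by rw [hU]; exact hpos.ne')
  exact ⟨_, inter_subset_left, hE.inter measurableSet_closedBall,
    isBounded_closedBall.subset inter_subset_right, hn⟩

variable {V : Type*} [NormedAddCommGroup V] [NormedSpace ℝ V] [MeasurableSpace V] [BorelSpace V]
  {E : Set V}

lemma two_pow_mul_hausdorffMeasure_le {s : ℝ} (hs : 0 ≤ s)
    (hmid : ∀ x ∈ E, ∀ y ∈ E, midpoint ℝ x y ∈ E) (h0 : (0 : V) ∈ E)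
    {ι : Type*} [Fintype ι] (b : Basis ι ℝ V) (hb : ∀ i, b i ∈ E) {F : Set V} (hFE : F ⊆ E)
    (hF : MeasurableSet F) {a : ℕ}
    (ha : ∀ x ∈ F, ∀ y ∈ F, ∀ i, |b.repr x i - b.repr y i| < 2 ^ a) (j : ℕ) :
    ((2 : ℝ≥0∞) ^ j) ^ Fintype.card ι * μH[s] F ≤
      ENNReal.ofReal (((2 : ℝ) ^ (j + a + (Fintype.card ι + 1))) ^ s) * μH[s] E := by
  classical
  let p : (ι → Fin (2 ^ j)) → V := fun k ↦ ∑ i, ((k i * 2 ^ a : ℕ) : ℝ) • b i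
  have hp : ∀ k i, b.repr (p k) i = k i * 2 ^ a := by
    intro k i
    rw [b.repr_sum_self]
    push_cast
    rfl
  have hdisj : Pairwise (Function.onFun Disjoint fun k ↦ p k +ᵥ F) := by
    intro k l hkl
    refine Set.disjoint_left.2 ?_
    rintro _ ⟨x, hx, rfl⟩ ⟨y, hy, hxy⟩
    refine hkl (funext fun i ↦ Fin.ext ?_)
    have hi := congrArg (fun v ↦ b.repr v i) hxy
    simp only [vadd_eq_add, map_add, Finsupp.add_apply, hp] at hi
    have hlt := ha y hy x hx i
    have heq : b.repr y i - b.repr x i = ((k i : ℝ) - l i) * 2 ^ a := by linarith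
    rw [heq, abs_mul, abs_of_pos (by positivity : (0 : ℝ) < 2 ^ a)] at hlt
    have h1 : |((k i : ℕ) : ℝ) - (l i : ℕ)| < 1 := by
      by_contra! h
      exact absurd hlt (not_lt.2 (le_mul_of_one_le_left (by positivity) h))
    have h2 : |((k i : ℕ) : ℤ) - (l i : ℕ)| < 1 := by exact_mod_cast h1
    rw [Int.abs_lt_one_iff] at h2
    omega
  have hsub : ⋃ k, (p k +ᵥ F) ⊆ ((2 : ℝ) ^ (j + a + (Fintype.card ι + 1))) • E := by
    refine iUnion_subset fun k ↦ ?_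
    rintro _ ⟨x, hx, rfl⟩
    refine sum_natCast_smul_add_mem_smul hmid h0 hb (fun i ↦ ?_) (hFE hx)
    rw [pow_add]
    exact Nat.mul_le_mul_right _ (k i).2.le
  have hle := measure_mono (μ := μH[s]) hsub
  rw [measure_iUnion hdisj fun k ↦ hF.const_vadd (p k),
    Measure.hausdorffMeasure_smul₀ hs (by positivity)] at hle
  simp only [measure_vadd, tsum_fintype, Finset.sum_const, Finset.card_univ, Fintype.card_pi,
    Fintype.card_fin, Finset.prod_const, nsmul_eq_mul] at hle
  push_cast at hle
  refine hle.trans (le_of_eq ?_)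
  rw [ENNReal.smul_def, smul_eq_mul]
  congr 1
  rw [ENNReal.ofReal, Real.toNNReal_rpow_of_nonneg (by positivity)]
  congr 2
  ext
  simp

variable [FiniteDimensional ℝ V]

lemma interior_nonempty_of_midpoint_mem_of_addHaar_pos (μ : Measure V) [μ.IsAddHaarMeasure]
    (hE : MeasurableSet E) (hmid : ∀ x ∈ E, ∀ y ∈ E, midpoint ℝ x y ∈ E) (hpos : 0 < μ E) :
    (interior E).Nonempty := by
  have hc : ∃ c : V, μ (E ∩ (fun x ↦ c - x) ⁻¹' E) ≠ 0 := by
    by_contra! h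
    have hT : MeasurableSet {z : V × V | z.2 ∈ E ∧ z.1 - z.2 ∈ E} :=
      (measurable_snd hE).inter ((measurable_fst.sub measurable_snd) hE)
    have h0 : (μ.prod μ) {z : V × V | z.2 ∈ E ∧ z.1 - z.2 ∈ E} = 0 := by
      rw [Measure.measure_prod_null hT]
      exact Eventually.of_forall h
    rw [Measure.prod_apply_symm hT, lintegral_eq_zero_iff (measurable_measure_prodMk_right hT)]
      at h0
    refine hpos.ne' (measure_mono_null ?_ h0)
    intro x hx
    simp only [mem_compl_iff, mem_ofPred_eq, Pi.zero_apply]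
    have : (fun c : V ↦ (c, x)) ⁻¹' {z : V × V | z.2 ∈ E ∧ z.1 - z.2 ∈ E}
        = (fun c ↦ c + -x) ⁻¹' E := by
      ext c
      simp [hx, sub_eq_add_neg]
    rw [this, measure_preimage_add_right]
    exact hpos.ne'
  obtain ⟨c, hc⟩ := hc
  set S := E ∩ (fun x ↦ c - x) ⁻¹' E with hS
  have hSm : MeasurableSet S := hE.inter ((measurable_const.sub measurable_id) hE)
  have hnhds := Measure.sub_mem_nhds_zero_of_addHaar_pos μ S hSm (pos_iff_ne_zero.2 hc)
  refine ⟨(2⁻¹ : ℝ) • c, mem_interior_iff_mem_nhds.2 ?_⟩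
  have hcont : ContinuousAt (fun z : V ↦ (2 : ℝ) • z - c) ((2⁻¹ : ℝ) • c) := by fun_prop
  refine mem_of_superset (hcont.preimage_mem_nhds (t := S - S) ?_) ?_
  · simpa using hnhds
  · rintro z ⟨x, hx, y, hy, hxy⟩
    have := hmid x hx.1 _ hy.2
    rw [midpoint_eq_smul_add] at this
    convert this using 1
    have h2 : x + (c - y) = (2 : ℝ) • z := by
      have hxy' : x - y = (2 : ℝ) • z - c := hxy
      rw [← sub_add_cancel ((2 : ℝ) • z) c, ← hxy']
      abel
    rw [h2, invOf_eq_inv, inv_smul_smul₀ two_ne_zero]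

lemma finrank_le_of_midpoint_mem_of_hausdorffMeasure {s : ℝ} (hs : 0 ≤ s) (hE : MeasurableSet E)
    (hmid : ∀ x ∈ E, ∀ y ∈ E, midpoint ℝ x y ∈ E) (h0 : (0 : V) ∈ E)
    (hspan : Submodule.span ℝ E = ⊤) (hpos : 0 < μH[s] E) (hfin : μH[s] E < ∞) :
    (finrank ℝ V : ℝ) ≤ s := by
  obtain ⟨ι, _, b, hb⟩ : ∃ (ι : Type _) (_ : Fintype ι) (b : Basis ι ℝ V), ∀ i, b i ∈ E := by
    refine ⟨_, FiniteDimensional.fintypeBasisIndex (Basis.ofSpan hspan.ge), Basis.ofSpan hspan.ge,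
      fun i ↦ Basis.ofSpan_subset hspan.ge (mem_range_self i)⟩
  obtain ⟨F, hFE, hF, hFb, hFpos⟩ := exists_bounded_subset_hausdorffMeasure_pos hE hpos
  obtain ⟨a, ha⟩ := exists_abs_repr_sub_lt b hFb
  rw [finrank_eq_card_basis b]
  set m := Fintype.card ι
  by_contra! hlt
  have hFfin : μH[s] F ≠ ∞ := ((measure_mono hFE).trans_lt hfin).ne
  have hα : 0 < (μH[s] F).toReal := ENNReal.toReal_pos hFpos.ne' hFfin
  set α := (μH[s] F).toReal
  set β := (μH[s] E).toReal
  set C : ℝ := ((2 : ℝ) ^ (a + (m + 1))) ^ s * β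
  have hbound : ∀ j : ℕ, ((2 : ℝ) ^ (m - s)) ^ j ≤ C / α := by
    intro j
    have h := two_pow_mul_hausdorffMeasure_le hs hmid h0 b hb hFE hF ha j
    have h' := ENNReal.toReal_mono (ENNReal.mul_ne_top ENNReal.ofReal_ne_top hfin.ne) h
    rw [ENNReal.toReal_mul, ENNReal.toReal_mul, ENNReal.toReal_ofReal (by positivity),
      ENNReal.toReal_pow, ENNReal.toReal_pow, ENNReal.toReal_ofNat, add_assoc, pow_add,
      Real.mul_rpow (by positivity) (by positivity), mul_assoc] at h'
    rw [le_div_iff₀ hα, Real.rpow_sub two_pos, Real.rpow_natCast, div_pow, div_mul_eq_mul_div,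
      div_le_iff₀ (by positivity)]
    have e1 : ((2 : ℝ) ^ j) ^ s = ((2 : ℝ) ^ s) ^ j := Real.rpow_pow_comm two_pos.le s j ▸ rfl
    rw [← pow_mul, mul_comm m j, pow_mul, mul_comm C, ← e1]
    exact h'
  obtain ⟨j, hj⟩ := pow_unbounded_of_one_lt (C / α)
    (Real.one_lt_rpow one_lt_two (sub_pos.2 hlt) : 1 < (2 : ℝ) ^ (m - s))
  exact absurd (hbound j) (not_le.2 hj)

lemma le_finrank_of_hausdorffMeasure_pos {s : ℝ} (hs : 0 ≤ s) (hpos : 0 < μH[s] E) :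
    s ≤ finrank ℝ V := by
  by_contra! hlt
  lift s to NNReal using hs
  refine hpos.ne' (hausdorffMeasure_of_dimH_lt ?_)
  calc dimH E ≤ dimH (univ : Set V) := dimH_mono (subset_univ E)
    _ = finrank ℝ V := Real.dimH_univ_eq_finrank V
    _ < s := by exact_mod_cast hlt

lemma finrank_eq_of_midpoint_mem_of_hausdorffMeasure {s : ℝ} (hs : 0 ≤ s) (hE : MeasurableSet E)
    (hmid : ∀ x ∈ E, ∀ y ∈ E, midpoint ℝ x y ∈ E) (h0 : (0 : V) ∈ E)
    (hspan : Submodule.span ℝ E = ⊤) (hpos : 0 < μH[s] E) (hfin : μH[s] E < ∞) :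
    (finrank ℝ V : ℝ) = s :=
  (finrank_le_of_midpoint_mem_of_hausdorffMeasure hs hE hmid h0 hspan hpos hfin).antisymm
    (le_finrank_of_hausdorffMeasure_pos hs hpos)

end Measure

/-- The translation by `p` identifies a linear subspace with its translate through `p`. -/
def submoduleHomeomorphMk' {V : Type*} [NormedAddCommGroup V] [NormedSpace ℝ V] (p : V)
    (W : Submodule ℝ V) : W ≃ₜ AffineSubspace.mk' p W where
  toFun v := ⟨v + p, by simp [AffineSubspace.mem_mk']⟩
  invFun x := ⟨x - p, by simpa using AffineSubspace.mem_mk'.1 x.2⟩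
  left_inv v := by simp
  right_inv x := by simp
  continuous_toFun := by fun_prop
  continuous_invFun := by fun_prop

theorem essentiallyConvex_of_midpointConvex_of_hausdorffMeasure_pos_finite
    (d : ℕ) (s : ℝ) (hs : 0 < s) (hsd : s < d)
    (E : Set (EuclideanSpace ℝ (Fin d))) (hE : MeasurableSet E)
    (hmid : MidpointConvexSet E)
    (hpos : 0 < μH[s] E) (hfin : μH[s] E < ∞) :
    EssentiallyConvex E := by
  obtain ⟨p, hp⟩ : E.Nonempty := nonempty_of_measure_ne_zero hpos.ne'
  let W := vectorSpan ℝ E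
  let φ : W →ᵃ[ℝ] EuclideanSpace ℝ (Fin d) :=
    W.subtype.toAffineMap + AffineMap.const ℝ W p
  have hφ : ∀ v, φ v = v + p := fun v ↦ rfl
  have hiso : Isometry φ := Isometry.of_dist_eq fun v w ↦ by
    rw [hφ, hφ, dist_add_right, Subtype.dist_eq]
  have hEW : ∀ x ∈ E, x - p ∈ W := fun x hx ↦ vsub_mem_vectorSpan ℝ hx hp
  have hrange : E ⊆ range φ := fun x hx ↦ ⟨⟨x - p, hEW x hx⟩, by simp [hφ]⟩
  set E' : Set W := φ ⁻¹' E with hE'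
  have himage : φ '' E' = E := image_preimage_eq_of_subset hrange
  have hE'm : MeasurableSet E' := hiso.continuous.measurable hE
  have hmid' : ∀ x ∈ E', ∀ y ∈ E', midpoint ℝ x y ∈ E' := fun x hx y hy ↦ by
    rw [hE', mem_preimage, AffineMap.map_midpoint]
    exact hmid _ hx _ hy
  have h0 : (0 : W) ∈ E' := by simpa [hE', hφ] using hp
  have hmeas : μH[s] E' = μH[s] E := by
    rw [← himage, hiso.hausdorffMeasure_image (Or.inl hs.le)]
  have hspan : Submodule.span ℝ E' = ⊤ := by
    refine Submodule.map_injective_of_injective W.injective_subtype ?_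
    rw [Submodule.map_span, Submodule.map_top, Submodule.range_subtype]
    refine Eq.trans ?_ (vectorSpan_eq_span_vsub_set_right ℝ hp).symm
    congr 1
    ext x
    constructor
    · rintro ⟨v, hv, rfl⟩
      exact ⟨v + p, hv, by simp⟩
    · rintro ⟨y, hy, rfl⟩
      exact ⟨⟨y - p, hEW y hy⟩, by simpa [hE', hφ] using hy, rfl⟩
  have hrank : (finrank ℝ W : ℝ) = s := finrank_eq_of_midpoint_mem_of_hausdorffMeasure hs.le hE'm
    hmid' h0 hspan (hmeas ▸ hpos) (hmeas ▸ hfin)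
  have hint : (interior E').Nonempty :=
    interior_nonempty_of_midpoint_mem_of_addHaar_pos μH[finrank ℝ W] hE'm hmid'
      (by rw [hrank, hmeas]; exact hpos)
  have hhull := interior_convexHull_subset_of_midpoint_mem hmid' hint
  have hconv : φ ⁻¹' (convexHull ℝ E) = convexHull ℝ E' := by
    conv_lhs => rw [← himage, ← φ.image_convexHull]
    exact preimage_image_eq _ hiso.injective
  let ψ := submoduleHomeomorphMk' p W
  refine ⟨finrank ℝ W, ?_, ?_, AffineSubspace.mk' p W, ?_, ?_, ?_, ?_⟩
  · exact_mod_cast hrank.symm ▸ hs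
  · simpa using Submodule.finrank_le W
  · rw [AffineSubspace.direction_mk']
  · exact fun x hx ↦ AffineSubspace.mem_mk'.2 (hEW x hx)
  · obtain ⟨v, hv⟩ := hint
    refine ⟨ψ v, ?_⟩
    rw [← mem_preimage, ψ.preimage_interior]
    exact hv
  · rw [← ψ.surjective.preimage_subset_preimage_iff, ψ.preimage_frontier]
    change φ ⁻¹' (convexHull ℝ E \ E) ⊆ frontier (φ ⁻¹' (convexHull ℝ E))
    rw [preimage_sdiff, hconv]
    exact fun v hv ↦ ⟨subset_closure hv.1, fun h ↦ hv.2 (hhull h)⟩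
end

section
/- For every s with 0 < s < d there exists a Borel set E₂ ⊆ ℝ^d of Hausdorff dimension s that is mid-point convex but not essentially convex and satisfies H^s(E₂) = ∞. -/
open MeasureTheory Set Metric Filter
open scoped ENNReal

/-- The reals that, up to an error `2 ^ C / 2 ^ L (k + 1)`, are dyadic rationals with denominator
`2 ^ (m k + C)`, for every `k`. -/
def dyadicGapSet (m L : ℕ → ℕ) (C : ℕ) : Set ℝ :=
  {x | ∀ k, ∃ a : ℤ, |x - a / 2 ^ (m k + C)| ≤ 2 ^ C / 2 ^ L (k + 1)}

/-- The points of `ℝ^d` all of whose coordinates lie in a common `dyadicGapSet m L C`. -/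
def dyadicGapModule (d : ℕ) (m L : ℕ → ℕ) : Set (EuclideanSpace ℝ (Fin d)) :=
  ⋃ C, {x | ∀ i, x i ∈ dyadicGapSet m L C}

section GapSet

variable {m L : ℕ → ℕ}

lemma dyadicGapSet_mono : Monotone (dyadicGapSet m L) := by
  refine monotone_nat_of_le_succ fun C x hx k ↦ ?_
  obtain ⟨a, ha⟩ := hx k
  refine ⟨2 * a, ?_⟩
  have h : ((2 * a : ℤ) : ℝ) / 2 ^ (m k + (C + 1)) = a / 2 ^ (m k + C) := by
    push_cast
    rw [← add_assoc, pow_succ]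
    field_simp
  rw [h]
  refine ha.trans ?_
  gcongr
  · norm_num
  · omega

lemma midpoint_mem_dyadicGapSet {C : ℕ} {x y : ℝ} (hx : x ∈ dyadicGapSet m L C)
    (hy : y ∈ dyadicGapSet m L C) : (x + y) / 2 ∈ dyadicGapSet m L (C + 1) := by
  intro k
  obtain ⟨a, ha⟩ := hx k
  obtain ⟨b, hb⟩ := hy k
  refine ⟨a + b, ?_⟩
  have h : (x + y) / 2 - ((a + b : ℤ) : ℝ) / 2 ^ (m k + (C + 1))
      = ((x - a / 2 ^ (m k + C)) + (y - b / 2 ^ (m k + C))) / 2 := by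
    push_cast
    rw [← add_assoc, pow_succ]
    field_simp
    ring
  rw [h, abs_div, abs_two, pow_succ, mul_comm (2 ^ C : ℝ) 2, mul_div_assoc]
  have := abs_add_le (x - a / 2 ^ (m k + C)) (y - b / 2 ^ (m k + C))
  have h0 : (0 : ℝ) ≤ 2 ^ C / 2 ^ L (k + 1) := by positivity
  linarith

lemma two_mul_mem_dyadicGapSet {C : ℕ} {x : ℝ} (hx : x ∈ dyadicGapSet m L C) :
    2 * x ∈ dyadicGapSet m L (C + 1) := by
  intro k
  obtain ⟨a, ha⟩ := hx k
  refine ⟨4 * a, ?_⟩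
  have h : 2 * x - ((4 * a : ℤ) : ℝ) / 2 ^ (m k + (C + 1)) = 2 * (x - a / 2 ^ (m k + C)) := by
    push_cast
    rw [← add_assoc, pow_succ]
    field_simp
    ring
  rw [h, abs_mul, abs_two, pow_succ, mul_comm (2 ^ C : ℝ) 2, mul_div_assoc]
  linarith

lemma intCast_mem_dyadicGapSet (n : ℤ) : (n : ℝ) ∈ dyadicGapSet m L 0 := by
  intro k
  refine ⟨n * 2 ^ m k, ?_⟩
  have : (n : ℝ) - ((n * 2 ^ m k : ℤ) : ℝ) / 2 ^ (m k + 0) = 0 := by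
    push_cast
    rw [add_zero]
    field_simp
    ring
  rw [this, abs_zero]
  positivity

lemma measurableSet_dyadicGapSet (C : ℕ) : MeasurableSet (dyadicGapSet m L C) := by
  simp only [dyadicGapSet, ofPred_forall, ofPred_exists]
  refine MeasurableSet.iInter fun k ↦ MeasurableSet.iUnion fun a ↦ ?_
  exact measurableSet_le (by fun_prop) (by fun_prop)

end GapSet

section Module

variable {d : ℕ} {m L : ℕ → ℕ}

lemma measurableSet_dyadicGapModule : MeasurableSet (dyadicGapModule d m L) := by
  refine MeasurableSet.iUnion fun C ↦ ?_
  simp only [ofPred_forall]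
  exact MeasurableSet.iInter fun i ↦
    (measurableSet_dyadicGapSet C).preimage (f := fun x : EuclideanSpace ℝ (Fin d) ↦ x i)
      (by fun_prop)

lemma midpointConvexSet_dyadicGapModule : MidpointConvexSet (dyadicGapModule d m L) := by
  intro x hx y hy
  obtain ⟨C, hC⟩ := mem_iUnion.1 hx
  obtain ⟨C', hC'⟩ := mem_iUnion.1 hy
  refine mem_iUnion.2 ⟨max C C' + 1, fun i ↦ ?_⟩
  have := midpoint_mem_dyadicGapSet (dyadicGapSet_mono (le_max_left C C') (hC i))
    (dyadicGapSet_mono (le_max_right C C') (hC' i))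
  convert this using 1
  simp [midpoint_eq_smul_add]
  ring

open scoped Pointwise in
lemma hausdorffMeasure_dyadicGapModule_eq_top {s : ℝ} (hs : 0 < s)
    (h : μH[s] (dyadicGapModule d m L) ≠ 0) : μH[s] (dyadicGapModule d m L) = ∞ := by
  have hsub : (2 : ℝ) • dyadicGapModule d m L ⊆ dyadicGapModule d m L := by
    rintro _ ⟨x, hx, rfl⟩
    obtain ⟨C, hC⟩ := mem_iUnion.1 hx
    exact mem_iUnion.2 ⟨C + 1, fun i ↦ by simpa using two_mul_mem_dyadicGapSet (hC i)⟩
  by_contra htop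
  have h1 := measure_mono (μ := μH[s]) hsub
  rw [Measure.hausdorffMeasure_smul₀ hs.le two_ne_zero, ENNReal.smul_def, smul_eq_mul] at h1
  have h2 : (1 : ℝ≥0∞) < ((‖(2 : ℝ)‖₊ ^ s : NNReal) : ℝ≥0∞) := by
    rw [← ENNReal.coe_one, ENNReal.coe_lt_coe]
    exact NNReal.one_lt_rpow (by simp) hs
  have h3 := (ENNReal.mul_lt_mul_iff_left h htop).2 h2
  rw [one_mul] at h3
  exact absurd h1 (not_le.2 h3)

lemma not_essentiallyConvex_dyadicGapModule (hdim : dimH (dyadicGapModule d m L) < d) :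
    ¬ EssentiallyConvex (dyadicGapModule d m L) := by
  rintro ⟨k, -, -, A, -, hA, hint, -⟩
  have hmem : ∀ z : Fin d → ℤ, WithLp.toLp 2 (fun i ↦ (z i : ℝ)) ∈ dyadicGapModule d m L :=
    fun z ↦ mem_iUnion.2 ⟨0, fun i ↦ intCast_mem_dyadicGapSet (z i)⟩
  have h0 : (0 : EuclideanSpace ℝ (Fin d)) ∈ A := by
    have h : (0 : EuclideanSpace ℝ (Fin d)) = WithLp.toLp 2 fun i ↦ (((0 : Fin d → ℤ) i : ℤ) : ℝ) := by
      ext i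
      simp
    exact h ▸ hA (hmem 0)
  have hdir : A.direction = ⊤ := by
    rw [eq_top_iff, ← (EuclideanSpace.basisFun (Fin d) ℝ).toBasis.span_eq, Submodule.span_le]
    rintro _ ⟨i, rfl⟩
    have h1 : EuclideanSpace.single i (1 : ℝ) ∈ A := by
      have h : EuclideanSpace.single i (1 : ℝ) =
          WithLp.toLp 2 fun j ↦ (((Pi.single i 1 : Fin d → ℤ) j : ℤ) : ℝ) := by
        ext j
        simp [Pi.single_apply]
      exact h ▸ hA (hmem (Pi.single i 1))
    simpa using AffineSubspace.vsub_mem_direction h1 h0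
  have htop : A = ⊤ := (AffineSubspace.direction_eq_top_iff_of_nonempty ⟨0, h0⟩).1 hdir
  subst htop
  obtain ⟨x, hx⟩ := hint
  have hx' : (x : EuclideanSpace ℝ (Fin d)) ∈ interior (dyadicGapModule d m L) := by
    rw [mem_interior_iff_mem_nhds] at hx ⊢
    rw [mem_nhds_subtype_iff_nhdsWithin] at hx
    simp only [AffineSubspace.top_coe, nhdsWithin_univ] at hx
    exact mem_of_superset hx (image_preimage_subset _ _)
  have := Real.dimH_of_mem_nhds (mem_interior_iff_mem_nhds.1 hx')
  simp [this] at hdim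

end Module

/-- Blocks of binary positions: the `k`-th block occupies the positions in `(L k, m k]`, its length
is `p (k + 1) - p k`, and the positions in `(m k, L (k + 1)]` are left empty. The density of the
occupied positions is governed by the exponent `r`. -/
structure IsBlockScheme (r : ℝ) (p m L : ℕ → ℕ) : Prop where
  p_zero : p 0 = 0
  p_mono : Monotone p
  block (k : ℕ) : m k + p k = L k + p (k + 1)
  gap (k : ℕ) : m k < L (k + 1)
  mul_le (k : ℕ) : r * L k ≤ p k
  eventually_le (t : ℝ) (ht : 1 < t) : ∀ᶠ k in atTop, (m k : ℝ) ≤ t * r * L (k + 1)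

lemma exists_isBlockScheme {r : ℝ} (hr0 : 0 < r) (hr1 : r < 1) :
    ∃ p m L : ℕ → ℕ, IsBlockScheme r p m L := by
  obtain ⟨B, hB⟩ := exists_nat_ge (2 / (1 / r - 1))
  have hr : 0 < 1 / r - 1 := by rw [sub_pos, lt_div_iff₀ hr0]; linarith
  have hB2 : 2 ≤ B * (1 / r - 1) := by rwa [div_le_iff₀ hr] at hB
  have hB0 : 0 < B := by
    rcases Nat.eq_zero_or_pos B with h | h
    · subst h
      norm_num at hB2
    · exact h
  let M : ℕ → ℕ := fun n ↦ ⌊(n : ℝ) / r⌋₊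
  have hM_le (n : ℕ) : (M n : ℝ) ≤ n / r := Nat.floor_le (by positivity)
  have hM_gt (n : ℕ) : n / r - 1 < (M n : ℝ) := Nat.sub_one_lt_floor _
  have hM_ge (n : ℕ) : n ≤ M n := by
    refine Nat.le_floor ?_
    rw [le_div_iff₀ hr0]
    nlinarith [(Nat.cast_nonneg n : (0 : ℝ) ≤ n)]
  let p : ℕ → ℕ := fun n ↦ Nat.rec 0 (fun k q ↦ (k + B) * (M q + 1)) n
  have hp (k : ℕ) : p (k + 1) = (k + B) * (M (p k) + 1) := rfl
  have hp_le (k : ℕ) : p k ≤ p (k + 1) := by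
    rw [hp]
    nlinarith [hM_ge (p k), Nat.zero_le k, Nat.zero_le (M (p k))]
  refine ⟨p, fun k ↦ M (p k) + (p (k + 1) - p k), fun k ↦ M (p k), rfl,
    monotone_nat_of_le_succ hp_le, fun k ↦ ?_, fun k ↦ ?_, fun k ↦ ?_, fun t ht ↦ ?_⟩
  · have := hp_le k
    omega
  · have h1 : (M (p k) : ℝ) + p (k + 1) + 1 ≤ p (k + 1) / r - 1 := by
      have h2 : (p (k + 1) : ℝ) = (k + B) * (M (p k) + 1) := by rw [hp]; push_cast; rfl
      have h3 : (p (k + 1) : ℝ) / r = p (k + 1) + p (k + 1) * (1 / r - 1) := by ring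
      have h4 : (M (p k) + 1 : ℝ) * 2 ≤ p (k + 1) * (1 / r - 1) := by
        rw [h2]
        have : 0 ≤ (M (p k) + 1 : ℝ) * (k * (1 / r - 1)) := by positivity
        have := mul_le_mul_of_nonneg_left hB2 (by positivity : 0 ≤ (M (p k) + 1 : ℝ))
        linarith
      have : (0 : ℝ) ≤ M (p k) := by positivity
      linarith
    have h2 := h1.trans_lt (hM_gt (p (k + 1)))
    have h3 : M (p k) + p (k + 1) + 1 < M (p (k + 1)) := by exact_mod_cast h2
    omega
  · have := hM_le (p k)
    rwa [le_div_iff₀ hr0, mul_comm] at this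
  · obtain ⟨K, hK⟩ := exists_nat_ge ((1 + t * r) / (t - 1))
    filter_upwards [eventually_ge_atTop K] with k hk
    have hk' : 1 + t * r ≤ k * (t - 1) := by
      rw [div_le_iff₀ (by linarith)] at hK
      have : (K : ℝ) ≤ k := by exact_mod_cast hk
      nlinarith
    have h1 : ((M (p k) + (p (k + 1) - p k) : ℕ) : ℝ) ≤ M (p k) + p (k + 1) := by
      exact_mod_cast (by omega)
    have h2 : (p (k + 1) : ℝ) = (k + B) * (M (p k) + 1) := by rw [hp]; push_cast; rfl
    have h3 : t * r * (p (k + 1) / r - 1) ≤ t * r * M (p (k + 1)) :=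
      mul_le_mul_of_nonneg_left (hM_gt _).le (by positivity)
    have h4 : t * r * (p (k + 1) / r - 1) = t * p (k + 1) - t * r := by field_simp
    have h5 : M (p k) + t * r ≤ (t - 1) * p (k + 1) := by
      rw [h2]
      have h6 := mul_le_mul_of_nonneg_left hk' (by positivity : 0 ≤ (M (p k) + 1 : ℝ))
      have h7 : 0 ≤ (M (p k) + 1 : ℝ) * (B * (t - 1)) := by
        have : 0 ≤ t - 1 := by linarith
        positivity
      have h8 : 0 ≤ (M (p k) : ℝ) * (t * r) := by positivity
      nlinarith
    linarith

namespace IsBlockScheme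

variable {r : ℝ} {p m L : ℕ → ℕ}

lemma strictMono (h : IsBlockScheme r p m L) : StrictMono L :=
  strictMono_nat_of_lt_succ fun k ↦ by
    have := h.block k
    have := h.gap k
    have := h.p_mono (Nat.le_add_right k 1)
    omega

lemma monotone_m (h : IsBlockScheme r p m L) : Monotone m :=
  monotone_nat_of_le_succ fun k ↦ by
    have := h.block (k + 1)
    have := h.gap k
    have := h.p_mono (Nat.le_add_right (k + 1) 1)
    omega

lemma tendsto_p (h : IsBlockScheme r p m L) (hr0 : 0 < r) : Tendsto p atTop atTop := by
  rw [← tendsto_natCast_atTop_iff (R := ℝ)]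
  exact tendsto_atTop_mono h.mul_le
    ((tendsto_natCast_atTop_atTop.comp h.strictMono.tendsto_atTop).const_mul_atTop hr0)

end IsBlockScheme

/-- The integer value of the `k`-th block of binary digits of `y`. -/
noncomputable def binaryBlock (p : ℕ → ℕ) (y : ℝ) (k : ℕ) : ℤ :=
  ⌊2 ^ p (k + 1) * y⌋ - 2 ^ (p (k + 1) - p k) * ⌊2 ^ p k * y⌋

/-- The sum of the first `n` blocks of binary digits of `y`, the `k`-th block being moved so as to
end at position `m k`. -/
noncomputable def spreadBlocks (p m : ℕ → ℕ) (y : ℝ) (n : ℕ) : ℝ :=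
  ∑ k ∈ Finset.range n, (binaryBlock p y k : ℝ) / 2 ^ m k

section Blocks

variable {r : ℝ} {p m L : ℕ → ℕ}

lemma IsBlockScheme.two_pow_mul (h : IsBlockScheme r p m L) (y : ℝ) (k : ℕ) :
    2 ^ p (k + 1) * y = 2 ^ (p (k + 1) - p k) * (2 ^ p k * y) := by
  rw [← mul_assoc, ← pow_add, Nat.sub_add_cancel (h.p_mono (Nat.le_add_right k 1))]

lemma IsBlockScheme.binaryBlock_nonneg (h : IsBlockScheme r p m L) (y : ℝ) (k : ℕ) :
    0 ≤ binaryBlock p y k := by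
  rw [binaryBlock, sub_nonneg, Int.le_floor, h.two_pow_mul]
  push_cast
  gcongr
  exact Int.floor_le _

lemma IsBlockScheme.binaryBlock_lt (h : IsBlockScheme r p m L) (y : ℝ) (k : ℕ) :
    binaryBlock p y k + 1 ≤ 2 ^ (p (k + 1) - p k) := by
  rw [Int.add_one_le_iff, binaryBlock, sub_lt_iff_lt_add, ← mul_one_add, Int.floor_lt,
    h.two_pow_mul]
  push_cast
  gcongr
  rw [add_comm]
  exact Int.lt_floor_add_one _

lemma IsBlockScheme.m_eq (h : IsBlockScheme r p m L) (k : ℕ) : m k = (p (k + 1) - p k) + L k := by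
  have := h.block k
  have := h.p_mono (Nat.le_add_right k 1)
  omega

lemma IsBlockScheme.exists_spread (h : IsBlockScheme r p m L) (y : ℝ) :
    ∃ x, ∀ n, spreadBlocks p m y n ≤ x ∧ x ≤ spreadBlocks p m y n + 1 / 2 ^ L n := by
  have hS (n : ℕ) : spreadBlocks p m y (n + 1) =
    spreadBlocks p m y n + binaryBlock p y n / 2 ^ m n := Finset.sum_range_succ _ _
  have hmono : Monotone (spreadBlocks p m y) := monotone_nat_of_le_succ fun n ↦ by
    rw [hS, le_add_iff_nonneg_right]
    have : (0 : ℝ) ≤ binaryBlock p y n := by exact_mod_cast h.binaryBlock_nonneg y n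
    positivity
  have hanti : Antitone fun n ↦ spreadBlocks p m y n + 1 / 2 ^ L n :=
    antitone_nat_of_succ_le fun n ↦ by
      have h1 : (binaryBlock p y n : ℝ) + 1 ≤ 2 ^ (p (n + 1) - p n) := by
        exact_mod_cast h.binaryBlock_lt y n
      have h2 : (1 : ℝ) / 2 ^ L (n + 1) ≤ 1 / 2 ^ m n := by
        gcongr
        · norm_num
        · exact (h.gap n).le
      have h3 : ((binaryBlock p y n : ℝ) + 1) / 2 ^ m n ≤ 1 / 2 ^ L n := by
        rw [h.m_eq, pow_add, div_le_div_iff₀ (by positivity) (by positivity), one_mul]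
        gcongr
      rw [hS]
      rw [add_div] at h3
      linarith
  refine ⟨_, fun n ↦ mem_iInter.1 (hmono.ciSup_mem_iInter_Icc_of_antitone hanti fun n ↦ ?_) n⟩
  exact le_add_of_nonneg_right (by positivity)

/-- The real number whose `k`-th block of binary digits, in the positions `(L k, m k]`, is the
`k`-th block of `y`, and whose other digits vanish. -/
noncomputable def IsBlockScheme.spread (h : IsBlockScheme r p m L) (y : ℝ) : ℝ :=
  (h.exists_spread y).choose

lemma IsBlockScheme.le_spread (h : IsBlockScheme r p m L) (y : ℝ) (n : ℕ) :
    spreadBlocks p m y n ≤ h.spread y :=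
  ((h.exists_spread y).choose_spec n).1

lemma IsBlockScheme.spread_le (h : IsBlockScheme r p m L) (y : ℝ) (n : ℕ) :
    h.spread y ≤ spreadBlocks p m y n + 1 / 2 ^ L n :=
  ((h.exists_spread y).choose_spec n).2

lemma IsBlockScheme.exists_spreadBlocks_eq (h : IsBlockScheme r p m L) (y : ℝ) (n : ℕ) :
    ∃ a : ℤ, spreadBlocks p m y (n + 1) = a / 2 ^ m n := by
  refine ⟨∑ k ∈ Finset.range (n + 1), binaryBlock p y k * 2 ^ (m n - m k), ?_⟩
  rw [spreadBlocks]
  push_cast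
  rw [Finset.sum_div]
  refine Finset.sum_congr rfl fun k hk ↦ ?_
  have : m k ≤ m n := h.monotone_m (Nat.lt_succ_iff.1 (Finset.mem_range.1 hk))
  rw [div_eq_div_iff (by positivity) (by positivity), mul_assoc, ← pow_add,
    Nat.sub_add_cancel this]

lemma IsBlockScheme.spread_mem (h : IsBlockScheme r p m L) (y : ℝ) :
    h.spread y ∈ dyadicGapSet m L 0 := by
  intro k
  obtain ⟨a, ha⟩ := h.exists_spreadBlocks_eq y k
  refine ⟨a, ?_⟩
  rw [add_zero, ← ha, pow_zero, abs_of_nonneg (sub_nonneg.2 (h.le_spread y _)), sub_le_iff_le_add']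
  exact h.spread_le y _

lemma IsBlockScheme.sub_le_of_lt (h : IsBlockScheme r p m L) (hr0 : 0 < r) (hr1 : r < 1)
    {y z : ℝ} (hy : 0 ≤ y) (hyz : y < z) (hz : z < 1) :
    z - y ≤ 4 * |h.spread z - h.spread y| ^ r := by
  classical
  have hne : ∃ k, ⌊2 ^ p k * y⌋ ≠ ⌊2 ^ p k * z⌋ := by
    by_contra! hcon
    have h2 : Tendsto (fun k ↦ (1 / 2 : ℝ) ^ p k) atTop (nhds 0) :=
      (tendsto_pow_atTop_nhds_zero_of_lt_one (by norm_num) (by norm_num)).comp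
        (h.tendsto_p hr0)
    obtain ⟨k, hk⟩ := (h2.eventually_lt_const (sub_pos.2 hyz)).exists
    rw [div_pow, one_pow, div_lt_iff₀ (by positivity)] at hk
    have h3 := Int.abs_sub_lt_one_of_floor_eq_floor (hcon k).symm
    rw [abs_lt] at h3
    linarith [h3.2]
  obtain ⟨hk, hmin⟩ := And.intro (Nat.find_spec hne) fun j ↦ Nat.find_min (m := j) hne
  generalize Nat.find hne = k at hk hmin
  push Not at hmin
  obtain _ | n := k
  · rw [h.p_zero, pow_zero, one_mul, one_mul, Int.floor_eq_zero_iff.2 ⟨hy, hyz.trans hz⟩,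
      Int.floor_eq_zero_iff.2 ⟨hy.trans hyz.le, hz⟩] at hk
    exact absurd rfl hk
  set N : ℤ := ⌊2 ^ p (n + 1) * z⌋ - ⌊2 ^ p (n + 1) * y⌋ with hN
  have hN1 : 1 ≤ N := by
    have : ⌊2 ^ p (n + 1) * y⌋ ≤ ⌊2 ^ p (n + 1) * z⌋ := by gcongr
    omega
  have hNb : N = binaryBlock p z n - binaryBlock p y n := by
    rw [binaryBlock, binaryBlock, hmin n n.lt_succ_self]
    ring
  have hNq : N ≤ 2 ^ (p (n + 1) - p n) := by
    have := h.binaryBlock_lt z n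
    have := h.binaryBlock_nonneg y n
    omega
  have hN1' : (1 : ℝ) ≤ N := by exact_mod_cast hN1
  have hNq' : (N : ℝ) ≤ 2 ^ (p (n + 1) - p n) := by exact_mod_cast hNq
  have hle : z - y ≤ 2 * N / 2 ^ p (n + 1) := by
    rw [le_div_iff₀ (by positivity)]
    have h1 := Int.lt_floor_add_one (2 ^ p (n + 1) * z)
    have h2 := Int.floor_le (2 ^ p (n + 1) * y)
    have h3 : (N : ℝ) = ⌊2 ^ p (n + 1) * z⌋ - ⌊2 ^ p (n + 1) * y⌋ := by rw [hN]; push_cast; rfl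
    nlinarith
  have hS : spreadBlocks p m z n = spreadBlocks p m y n := by
    refine Finset.sum_congr rfl fun k hk ↦ ?_
    rw [Finset.mem_range] at hk
    rw [binaryBlock, binaryBlock, hmin k (by omega), hmin (k + 1) (by omega)]
  have hdist : N / 2 ^ m n / 2 ≤ |h.spread z - h.spread y| := by
    have h1 := h.le_spread z (n + 1)
    have h2 := h.spread_le y (n + 1)
    have h3 : spreadBlocks p m z (n + 1) - spreadBlocks p m y (n + 1) = N / 2 ^ m n := by
      rw [spreadBlocks, spreadBlocks, Finset.sum_range_succ, Finset.sum_range_succ,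
        ← spreadBlocks, ← spreadBlocks, hS, hNb]
      push_cast
      ring
    have h4 : (1 : ℝ) / 2 ^ L (n + 1) ≤ N / 2 ^ m n / 2 := by
      rw [div_div, ← pow_succ]
      gcongr
      · norm_num
      · exact h.gap n
    exact le_trans (by linarith) (le_abs_self _)
  have hpow : (N : ℝ) / 2 ^ p (n + 1) ≤ (N / 2 ^ m n) ^ r := by
    have h0 : (0 : ℝ) < N := by linarith
    have h1 : (N : ℝ) = N ^ r * N ^ (1 - r) := by
      rw [← Real.rpow_add h0]; simp
    have h2 : (N : ℝ) ^ (1 - r) ≤ (2 : ℝ) ^ (((p (n + 1) - p n : ℕ) : ℝ) * (1 - r)) := by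
      rw [Real.rpow_mul two_pos.le, Real.rpow_natCast]
      exact Real.rpow_le_rpow h0.le hNq' (by linarith)
    have h3 : (2 : ℝ) ^ (((p (n + 1) - p n : ℕ) : ℝ) * (1 - r)) * 2 ^ (m n * r)
        ≤ 2 ^ p (n + 1) := by
      rw [← Real.rpow_add two_pos, ← Real.rpow_natCast 2 (p (n + 1))]
      refine Real.rpow_le_rpow_of_exponent_le one_le_two ?_
      have h4 := h.mul_le n
      have h5 : ((m n : ℕ) : ℝ) = ((p (n + 1) - p n : ℕ) : ℝ) + L n := by
        exact_mod_cast h.m_eq n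
      have h6 : ((p (n + 1) - p n : ℕ) : ℝ) = p (n + 1) - p n :=
        Nat.cast_sub (h.p_mono (Nat.le_add_right n 1))
      rw [h5, h6]
      linarith
    rw [Real.div_rpow h0.le (by positivity), ← Real.rpow_natCast 2 (m n), ← Real.rpow_mul two_pos.le,
      div_le_div_iff₀ (by positivity) (by positivity)]
    calc (N : ℝ) * 2 ^ (m n * r) = N ^ r * (N ^ (1 - r) * 2 ^ (m n * r)) := by
          rw [← mul_assoc, ← h1]
      _ ≤ N ^ r * (2 ^ (((p (n + 1) - p n : ℕ) : ℝ) * (1 - r)) * 2 ^ (m n * r)) := by gcongr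
      _ ≤ N ^ r * 2 ^ p (n + 1) := by gcongr
  have hhalf : (N / 2 ^ m n : ℝ) ^ r ≤ 2 * (N / 2 ^ m n / 2) ^ r := by
    rw [Real.div_rpow (by positivity) two_pos.le]
    have h1 : (2 : ℝ) ^ r ≤ 2 := by
      simpa using Real.rpow_le_rpow_of_exponent_le one_le_two hr1.le
    rw [← mul_div_assoc, le_div_iff₀ (by positivity), mul_comm]
    gcongr
  have hfin : (N / 2 ^ m n / 2 : ℝ) ^ r ≤ |h.spread z - h.spread y| ^ r :=
    Real.rpow_le_rpow (by positivity) hdist hr0.le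
  have : 2 * (N : ℝ) / 2 ^ p (n + 1) = 2 * (N / 2 ^ p (n + 1)) := mul_div_assoc _ _ _
  linarith

lemma IsBlockScheme.abs_sub_le (h : IsBlockScheme r p m L) (hr0 : 0 < r) (hr1 : r < 1)
    {y z : ℝ} (hy : y ∈ Ico (0 : ℝ) 1) (hz : z ∈ Ico (0 : ℝ) 1) :
    |y - z| ≤ 4 * |h.spread y - h.spread z| ^ r := by
  rcases lt_trichotomy y z with hyz | rfl | hyz
  · rw [abs_sub_comm, abs_sub_comm (h.spread y), abs_of_pos (sub_pos.2 hyz)]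
    exact h.sub_le_of_lt hr0 hr1 hy.1 hyz hz.2
  · rw [sub_self, abs_zero]
    positivity
  · rw [abs_of_pos (sub_pos.2 hyz)]
    exact h.sub_le_of_lt hr0 hr1 hz.1 hyz hy.2

lemma IsBlockScheme.injOn_spread (h : IsBlockScheme r p m L) (hr0 : 0 < r) (hr1 : r < 1) :
    InjOn h.spread (Ico 0 1) := by
  intro y hy z hz hyz
  have := h.abs_sub_le hr0 hr1 hy hz
  rw [hyz, sub_self, abs_zero, Real.zero_rpow hr0.ne', mul_zero] at this
  exact sub_eq_zero.1 (abs_nonpos_iff.1 this)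

lemma IsBlockScheme.holderOnWith_invFunOn_spread (h : IsBlockScheme r p m L) (hr0 : 0 < r)
    (hr1 : r < 1) :
    HolderOnWith 4 r.toNNReal (Function.invFunOn h.spread (Ico 0 1)) (h.spread '' Ico 0 1) := by
  rintro _ ⟨y, hy, rfl⟩ _ ⟨z, hz, rfl⟩
  rw [(h.injOn_spread hr0 hr1).leftInvOn_invFunOn hy, (h.injOn_spread hr0 hr1).leftInvOn_invFunOn hz,
    edist_dist, edist_dist, Real.coe_toNNReal _ hr0.le,
    ENNReal.ofReal_rpow_of_nonneg dist_nonneg hr0.le, ENNReal.coe_ofNat,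
    ← ENNReal.ofReal_ofNat, ← ENNReal.ofReal_mul (by norm_num)]
  exact ENNReal.ofReal_le_ofReal (h.abs_sub_le hr0 hr1 hy hz)

end Blocks

section Dimension

variable {r : ℝ} {p m L : ℕ → ℕ}

lemma IsBlockScheme.hausdorffMeasure_dyadicGapModule_ne_zero (h : IsBlockScheme r p m L)
    (hr0 : 0 < r) (hr1 : r < 1) (d : ℕ) : μH[r * d] (dyadicGapModule d m L) ≠ 0 := by
  set K : Set (EuclideanSpace ℝ (Fin d)) := {x | ∀ i, x i ∈ h.spread '' Ico 0 1} with hK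
  set f : EuclideanSpace ℝ (Fin d) → (Fin d → ℝ) :=
    fun x i ↦ Function.invFunOn h.spread (Ico 0 1) (x i) with hf
  have hKsub : K ⊆ dyadicGapModule d m L := fun x hx ↦ mem_iUnion.2 ⟨0, fun i ↦ by
    obtain ⟨y, -, hy⟩ := hx i
    exact hy ▸ h.spread_mem y⟩
  have hfK : HolderOnWith 4 r.toNNReal f K := fun x hx y hy ↦ edist_pi_le_iff.2 fun i ↦ by
    refine (h.holderOnWith_invFunOn_spread hr0 hr1 _ (hx i) _ (hy i)).trans ?_
    gcongr
    simpa using (PiLp.lipschitzWith_ofLp 2 (fun _ : Fin d ↦ ℝ)).edist_le_mul x y |>.trans'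
      (edist_le_pi_edist _ _ i)
  have hcube : univ.pi (fun _ : Fin d ↦ Ico (0 : ℝ) 1) ⊆ f '' K := fun y hy ↦ by
    refine ⟨WithLp.toLp 2 fun i ↦ h.spread (y i), fun i ↦ ⟨y i, hy i (mem_univ i), rfl⟩, ?_⟩
    ext i
    exact (h.injOn_spread hr0 hr1).leftInvOn_invFunOn (hy i (mem_univ i))
  have h1 : (1 : ℝ≥0∞) ≤ μH[d] (f '' K) := by
    refine le_trans (le_of_eq ?_) (measure_mono hcube)
    have := hausdorffMeasure_pi_real (ι := Fin d)
    rw [Fintype.card_fin] at this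
    rw [this, Real.volume_pi_Ico]
    simp
  have h2 := hfK.hausdorffMeasure_image_le (Real.toNNReal_pos.2 hr0) (d := d) (Nat.cast_nonneg d)
  rw [Real.coe_toNNReal _ hr0.le] at h2
  intro h0
  rw [measure_mono_null hKsub h0, mul_zero] at h2
  exact absurd (h1.trans h2) (by simp)

lemma IsBlockScheme.dimH_cube_inter_le (h : IsBlockScheme r p m L) (hr0 : 0 < r) {d : ℕ}
    (C R : ℕ) {t : NNReal} (ht : r * d < t) :
    dimH {x : Fin d → ℝ | ∀ i, |x i| ≤ R ∧ x i ∈ dyadicGapSet m L C} ≤ t := by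
  rcases Nat.eq_zero_or_pos d with rfl | hd
  · rw [dimH_subsingleton subsingleton_of_subsingleton]
    exact bot_le
  have hd' : (0 : ℝ) < d := by exact_mod_cast hd
  have hdiam (n : ℕ) (z : Fin d → ℝ) : ediam (closedBall z (2 ^ C / 2 ^ L (n + 1) : ℝ)) ≤
      ENNReal.ofReal (2 * 2 ^ C * (1 / 2) ^ L (n + 1)) := by
    refine ediam_le fun x hx y hy ↦ ?_
    rw [edist_dist]
    refine ENNReal.ofReal_le_ofReal ((dist_triangle_right x y z).trans ?_)
    rw [mem_closedBall] at hx hy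
    have : (2 : ℝ) * 2 ^ C * (1 / 2) ^ L (n + 1) = 2 * (2 ^ C / 2 ^ L (n + 1)) := by
      rw [div_pow, one_pow]
      ring
    linarith
  refine dimH_le_of_hausdorffMeasure_ne_top (ne_top_of_le_ne_top ?_
    (Measure.hausdorffMeasure_le_liminf_sum (t : ℝ) _ (l := atTop)
      (ι := fun n ↦ Fin d → Finset.Icc (-((R + 2 ^ C) * 2 ^ (m n + C) : ℤ))
        ((R + 2 ^ C) * 2 ^ (m n + C)))
      (fun n ↦ ENNReal.ofReal (2 * 2 ^ C * (1 / 2) ^ L (n + 1))) ?_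
      (fun n a ↦ closedBall (fun i ↦ (a i : ℝ) / 2 ^ (m n + C)) (2 ^ C / 2 ^ L (n + 1)))
      (Eventually.of_forall fun n a ↦ ?_) (Eventually.of_forall fun n x hx ↦ ?_)))
  · have hτ : 1 < t / (r * d) := (one_lt_div (by positivity)).2 ht
    refine ne_top_of_le_ne_top (ENNReal.ofReal_ne_top
      (r := (3 * ((R + 2 ^ C) * 2 ^ C)) ^ d * (2 * 2 ^ C) ^ (t : ℝ)))
      (liminf_le_of_frequently_le' (Eventually.frequently ?_))
    filter_upwards [h.eventually_le _ hτ] with n hn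
    have hm : (2 : ℝ) ^ m n ≤ 2 ^ (L (n + 1) * t / d : ℝ) := by
      rw [← Real.rpow_natCast]
      refine Real.rpow_le_rpow_of_exponent_le one_le_two (hn.trans_eq ?_)
      field_simp
    have hmd : ((2 : ℝ) ^ m n) ^ d * ((1 / 2) ^ L (n + 1)) ^ (t : ℝ) ≤ 1 := by
      have h1 : ((2 : ℝ) ^ m n) ^ d ≤ 2 ^ (L (n + 1) * t : ℝ) := by
        refine (pow_le_pow_left₀ (by positivity) hm d).trans_eq ?_
        rw [← Real.rpow_mul_natCast two_pos.le, div_mul_cancel₀ _ hd'.ne']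
      rw [div_pow, one_pow, Real.div_rpow one_pos.le (by positivity), Real.one_rpow, mul_one_div,
        div_le_one (by positivity), ← Real.rpow_natCast_mul two_pos.le]
      exact h1
    set A : ℤ := (R + 2 ^ C) * 2 ^ (m n + C) with hA
    have hA1 : 1 ≤ A := by
      have : 0 < A := by positivity
      omega
    have hcard : (Fintype.card (Fin d → Finset.Icc (-A) A) : ℝ) ≤
        (3 * ((R + 2 ^ C) * 2 ^ C) * 2 ^ m n) ^ d := by
      rw [Fintype.card_fun, Fintype.card_fin, Fintype.card_coe, Int.card_Icc, Nat.cast_pow]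
      refine pow_le_pow_left₀ (Nat.cast_nonneg _) ?_ d
      have h1 : ((A + 1 - -A).toNat : ℤ) ≤ 3 * A := by omega
      have h2 : ((A + 1 - -A).toNat : ℝ) ≤ (3 * A : ℤ) := by exact_mod_cast h1
      refine h2.trans_eq ?_
      rw [hA]
      push_cast
      ring
    calc _ ≤ ∑ _a : Fin d → Finset.Icc (-A) A,
          ENNReal.ofReal (2 * 2 ^ C * (1 / 2) ^ L (n + 1)) ^ (t : ℝ) := by
          gcongr with a
          exact hdiam n _
      _ = ENNReal.ofReal (Fintype.card (Fin d → Finset.Icc (-A) A) *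
          (2 * 2 ^ C * (1 / 2) ^ L (n + 1)) ^ (t : ℝ)) := by
          rw [Finset.sum_const, nsmul_eq_mul, Finset.card_univ,
            ENNReal.ofReal_rpow_of_nonneg (by positivity) t.coe_nonneg,
            ENNReal.ofReal_mul (Nat.cast_nonneg _), ENNReal.ofReal_natCast]
      _ ≤ _ := by
          refine ENNReal.ofReal_le_ofReal ?_
          calc _ ≤ (3 * ((R + 2 ^ C) * 2 ^ C) * 2 ^ m n : ℝ) ^ d *
                (2 * 2 ^ C * (1 / 2) ^ L (n + 1)) ^ (t : ℝ) := by gcongr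
            _ = (3 * ((R + 2 ^ C) * 2 ^ C)) ^ d * (2 * 2 ^ C) ^ (t : ℝ) *
                (((2 : ℝ) ^ m n) ^ d * ((1 / 2) ^ L (n + 1)) ^ (t : ℝ)) := by
                rw [mul_pow _ (2 ^ m n : ℝ), Real.mul_rpow (by positivity) (by positivity)]
                ring
            _ ≤ _ := mul_le_of_le_one_right (by positivity) hmd
  · rw [← ENNReal.ofReal_zero]
    refine ENNReal.tendsto_ofReal ?_
    rw [← mul_zero (2 * 2 ^ C : ℝ)]
    refine Tendsto.const_mul _ ((tendsto_pow_atTop_nhds_zero_of_lt_one (by norm_num)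
      (by norm_num)).comp (h.strictMono.tendsto_atTop.comp (tendsto_add_atTop_nat 1)))
  · exact hdiam n _
  · choose a ha using fun i ↦ (hx i).2 n
    have hmem : ∀ i, a i ∈ Finset.Icc (-((R + 2 ^ C) * 2 ^ (m n + C) : ℤ))
        ((R + 2 ^ C) * 2 ^ (m n + C)) := by
      intro i
      rw [Finset.mem_Icc, ← abs_le]
      have h1 : |(a i : ℝ) / 2 ^ (m n + C)| ≤ R + 2 ^ C := by
        have h2 : (2 : ℝ) ^ C / 2 ^ L (n + 1) ≤ 2 ^ C :=
          div_le_self (by positivity) (one_le_pow₀ one_le_two)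
        have h3 := abs_sub_abs_le_abs_sub ((a i : ℝ) / 2 ^ (m n + C)) (x i)
        rw [abs_sub_comm] at h3
        linarith [ha i, (hx i).1]
      rw [abs_div, abs_of_pos (by positivity : (0 : ℝ) < 2 ^ (m n + C)),
        div_le_iff₀ (by positivity)] at h1
      exact_mod_cast h1
    refine mem_iUnion.2 ⟨fun i ↦ ⟨a i, hmem i⟩, ?_⟩
    rw [mem_closedBall, dist_pi_le_iff (by positivity)]
    exact ha

lemma IsBlockScheme.dimH_dyadicGapModule_le (h : IsBlockScheme r p m L) (hr0 : 0 < r) (d : ℕ) :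
    dimH (dyadicGapModule d m L) ≤ ENNReal.ofReal (r * d) := by
  refine le_of_forall_gt_imp_ge_of_dense fun t ht ↦ ?_
  induction t with
  | top => exact le_top
  | coe t =>
    rw [← ENNReal.ofReal_coe_nnreal, ENNReal.ofReal_lt_ofReal_iff_of_nonneg (by positivity)] at ht
    rw [← (EuclideanSpace.equiv (Fin d) ℝ).symm.dimH_preimage]
    have hsub : (EuclideanSpace.equiv (Fin d) ℝ).symm ⁻¹' dyadicGapModule d m L ⊆
        ⋃ C : ℕ, ⋃ R : ℕ, {x : Fin d → ℝ | ∀ i, |x i| ≤ R ∧ x i ∈ dyadicGapSet m L C} := by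
      intro x hx
      obtain ⟨C, hC⟩ := mem_iUnion.1 hx
      obtain ⟨R, hR⟩ := exists_nat_ge ‖x‖
      exact mem_iUnion₂.2 ⟨C, R, fun i ↦ ⟨(norm_le_pi_norm x i).trans hR, hC i⟩⟩
    refine (dimH_mono hsub).trans ?_
    simp only [dimH_iUnion]
    exact iSup₂_le fun C R ↦ h.dimH_cube_inter_le hr0 C R ht

end Dimension

theorem exists_midpointConvex_not_essentiallyConvex_hausdorffMeasure_infty
    (d : ℕ) (s : ℝ) (hs : 0 < s) (hsd : s < d) :
    ∃ E₂ : Set (EuclideanSpace ℝ (Fin d)), MeasurableSet E₂ ∧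
      dimH E₂ = ENNReal.ofReal s ∧ MidpointConvexSet E₂ ∧
      ¬ EssentiallyConvex E₂ ∧ μH[s] E₂ = ∞ := by
  have hd : (0 : ℝ) < d := hs.trans hsd
  have hr0 : 0 < s / d := div_pos hs hd
  have hr1 : s / d < 1 := (div_lt_one hd).2 hsd
  obtain ⟨p, m, L, h⟩ := exists_isBlockScheme hr0 hr1
  have hne := h.hausdorffMeasure_dyadicGapModule_ne_zero hr0 hr1 d
  have hle := h.dimH_dyadicGapModule_le hr0 d
  rw [div_mul_cancel₀ _ hd.ne'] at hne hle
  have hdim : dimH (dyadicGapModule d m L) = ENNReal.ofReal s := by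
    refine le_antisymm hle (le_dimH_of_hausdorffMeasure_ne_zero ?_)
    rwa [Real.coe_toNNReal _ hs.le]
  refine ⟨dyadicGapModule d m L, measurableSet_dyadicGapModule, hdim,
    midpointConvexSet_dyadicGapModule, not_essentiallyConvex_dyadicGapModule ?_,
    hausdorffMeasure_dyadicGapModule_eq_top hs hne⟩
  rw [hdim, ← ENNReal.ofReal_natCast]
  exact (ENNReal.ofReal_lt_ofReal_iff hd).2 hsd
end
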